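/- arXiv:2510.10884 — 3 statements merged into one kernel-verified Lean document; each statement's English description precedes it below -/
import Mathlib

section
/- Let K be a field of characteristic zero, let Δ be a pure, collapsible d-dimensional simplicial complex on vertex set [n], let a > 1 be an integer, set J = I_Δ + (x_1^a,…,x_n^a) ⊆ R = K[x_1,…,x_n] and L = x_1 + ⋯ + x_n. Then the multiplication map ×L : (R/J)_{d(a−1)} → (R/J)_{d(a−1)+1} is surjective; consequently ×L : (R/J)_j → (R/J)_{j+1} is surjective for every j ≥ d(a−1). -/
open MvPolynomial
open scoped Classical

/-- `Δ` is a simplicial complex on vertex set `Fin n`: it contains the empty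
face and is closed under taking subsets. -/
def IsComplex {n : ℕ} (Δ : Finset (Finset (Fin n))) : Prop :=
  ∅ ∈ Δ ∧ ∀ σ ∈ Δ, ∀ τ, τ ⊆ σ → τ ∈ Δ

/-- `Δ` has dimension `d`: every face has at most `d + 1` vertices and some
face has exactly `d + 1` vertices. -/
def HasDim {n : ℕ} (Δ : Finset (Finset (Fin n))) (d : ℕ) : Prop :=
  (∀ σ ∈ Δ, σ.card ≤ d + 1) ∧ ∃ σ ∈ Δ, σ.card = d + 1

/-- `f_{k-1}(Δ)`: the number of faces of `Δ` with exactly `k` vertices. -/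
noncomputable def faceCount {n : ℕ} (Δ : Finset (Finset (Fin n))) (k : ℕ) : ℕ :=
  (Δ.filter fun σ => σ.card = k).card

/-- The h-polynomial of a `d`-dimensional complex `Δ`, defined by
`∑_{i=0}^{d+1} f_{i-1}(Δ) (x-1)^{d+1-i} = ∑_{i=0}^{d+1} h_i x^{d+1-i}`;
obtained by reflecting the left-hand side in the window `[0, d+1]`. -/
noncomputable def hPoly {n : ℕ} (Δ : Finset (Finset (Fin n))) (d : ℕ) : Polynomial ℤ :=
  Polynomial.reflect (d + 1)
    (∑ i ∈ Finset.range (d + 2), (faceCount Δ i : ℤ) • (Polynomial.X - 1) ^ (d + 1 - i))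

/-- The Stanley–Reisner ideal of `Δ` in `K[x_1, …, x_n]`. -/
noncomputable def SRIdeal (K : Type) [Field K] {n : ℕ} (Δ : Finset (Finset (Fin n))) :
    Ideal (MvPolynomial (Fin n) K) :=
  Ideal.span {m | ∃ σ : Finset (Fin n), σ ∉ Δ ∧ m = ∏ i ∈ σ, X i}

/-- The ideal `(x_1^{a_1}, …, x_n^{a_n})`. -/
noncomputable def powersIdeal (K : Type) [Field K] (n : ℕ) (a : Fin n → ℕ) :
    Ideal (MvPolynomial (Fin n) K) :=
  Ideal.span (Set.range fun i : Fin n => (X i : MvPolynomial (Fin n) K) ^ a i)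

/-- `F` is a facet (maximal face) of `Δ`. -/
def IsFacet {n : ℕ} (Δ : Finset (Finset (Fin n))) (F : Finset (Fin n)) : Prop :=
  F ∈ Δ ∧ ∀ G ∈ Δ, F ⊆ G → F = G

/-- `Δ` is pure of dimension `d`: every facet has `d + 1` vertices. -/
def IsPure {n : ℕ} (Δ : Finset (Finset (Fin n))) (d : ℕ) : Prop :=
  ∀ F : Finset (Fin n), IsFacet Δ F → F.card = d + 1

/-- The finset of facets of `Δ`. -/
noncomputable def facetsF {n : ℕ} (Δ : Finset (Finset (Fin n))) : Finset (Finset (Fin n)) :=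
  Δ.filter fun F => ∀ G ∈ Δ, F ⊆ G → F = G

/-- The finset of ridges of a pure `d`-dimensional `Δ`: faces with `d` vertices. -/
noncomputable def ridgesF {n : ℕ} (Δ : Finset (Finset (Fin n))) (d : ℕ) :
    Finset (Finset (Fin n)) :=
  Δ.filter fun σ => σ.card = d

/-- The degree-`s` homogeneous component of `R/J`, as the image in the quotient
of the space of homogeneous polynomials of degree `s`. -/
noncomputable def quotComponent (K : Type) [Field K] {n : ℕ}
    (J : Ideal (MvPolynomial (Fin n) K)) (s : ℕ) :
    Submodule K (MvPolynomial (Fin n) K ⧸ J) :=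
  (MvPolynomial.homogeneousSubmodule (Fin n) K s).map (Ideal.Quotient.mkₐ K J).toLinearMap

/-- `dim_K (R/J)_s`. -/
noncomputable def quotDim (K : Type) [Field K] {n : ℕ}
    (J : Ideal (MvPolynomial (Fin n) K)) (s : ℕ) : ℕ :=
  Module.finrank K (quotComponent K J s)
/-- One elementary collapse: remove a free face `σ` (a face properly contained
in exactly one face `τ`) together with `τ`. -/
def CollapseStep {n : ℕ} (Δ Δ' : Finset (Finset (Fin n))) : Prop :=
  ∃ σ τ : Finset (Fin n), σ ∈ Δ ∧ τ ∈ Δ ∧ σ ⊂ τ ∧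
    (∀ η ∈ Δ, σ ⊂ η → η = τ) ∧ Δ' = Δ \ {σ, τ}

/-- `Δ` is collapsible: some sequence of elementary collapses reduces `Δ` to a
complex consisting of a single vertex. -/
def Collapsible {n : ℕ} (Δ : Finset (Finset (Fin n))) : Prop :=
  ∃ v : Fin n, Relation.ReflTransGen CollapseStep Δ {∅, {v}}

/-- The polynomials congruent modulo `J` to `L * x` for some `x` homogeneous of degree `j`. -/
noncomputable def mulImage {K : Type} [Field K] {n : ℕ} (J : Ideal (MvPolynomial (Fin n) K))
    (L : MvPolynomial (Fin n) K) (j : ℕ) : Submodule K (MvPolynomial (Fin n) K) :=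
  J.restrictScalars K ⊔ (homogeneousSubmodule (Fin n) K j).map (LinearMap.mulLeft K L)

lemma monomial_mem_SRIdeal (K : Type) [Field K] {n : ℕ} {Δ : Finset (Finset (Fin n))}
    {m : Fin n →₀ ℕ} (hm : m.support ∉ Δ) : monomial m (1 : K) ∈ SRIdeal K Δ := by
  have hdvd : (∏ i ∈ m.support, X i : MvPolynomial (Fin n) K) ∣ monomial m (1 : K) := by
    rw [monomial_eq, C_1, one_mul, Finsupp.prod]
    exact Finset.prod_dvd_prod_of_dvd _ _ fun i hi =>
      dvd_pow_self _ (Finsupp.mem_support_iff.mp hi)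
  exact Ideal.mem_of_dvd _ hdvd (Ideal.subset_span ⟨_, hm, rfl⟩)

lemma monomial_mem_powersIdeal (K : Type) [Field K] {n d a : ℕ} {m : Fin n →₀ ℕ}
    (hcard : m.support.card ≤ d) (hdeg : d * (a - 1) < m.degree) :
    monomial m (1 : K) ∈ powersIdeal K n fun _ => a := by
  obtain ⟨i, hi⟩ : ∃ i, a ≤ m i := by
    by_contra! h
    have hle : m.degree ≤ m.support.card * (a - 1) := by
      rw [Finsupp.degree_apply, ← smul_eq_mul]
      exact Finset.sum_le_card_nsmul _ _ _ fun i _ => Nat.le_sub_one_of_lt (h i)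
    exact absurd (hle.trans (Nat.mul_le_mul_right _ hcard)) (not_le.mpr hdeg)
  have hdvd : (X i ^ a : MvPolynomial (Fin n) K) ∣ monomial m (1 : K) := by
    rw [X_pow_eq_monomial, monomial_dvd_monomial]
    exact ⟨Or.inr (Finsupp.single_le_iff.mpr hi), one_dvd _⟩
  exact Ideal.mem_of_dvd _ hdvd (Ideal.subset_span ⟨i, rfl⟩)

/-- Modulo `L = ∑ k, X k`, a monomial divisible by `X i` is traded for the monomials obtained by
replacing one factor `X i` by some other variable. -/
lemma monomial_add_single_mem_mulImage {K : Type} [Field K] {n j : ℕ}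
    {J : Ideal (MvPolynomial (Fin n) K)} {w : Fin n →₀ ℕ} (hw : w.degree = j) (i : Fin n)
    (h : ∀ k ≠ i, monomial (w + Finsupp.single k 1) (1 : K) ∈ mulImage J (∑ k, X k) j) :
    monomial (w + Finsupp.single i 1) (1 : K) ∈ mulImage J (∑ k, X k) j := by
  have hL : (∑ k, X k) * monomial w (1 : K) ∈ mulImage J (∑ k, X k) j :=
    Submodule.mem_sup_right ⟨_, isHomogeneous_monomial _ hw, rfl⟩
  have hsum : (∑ k, X k) * monomial w (1 : K) =
      ∑ k, monomial (w + Finsupp.single k 1) (1 : K) := by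
    rw [Finset.sum_mul]
    refine Finset.sum_congr rfl fun k _ => ?_
    rw [X, monomial_mul, one_mul, add_comm]
  rw [hsum, ← Finset.add_sum_erase _ (fun k => monomial (w + Finsupp.single k 1) (1 : K))
    (Finset.mem_univ i)] at hL
  exact (Submodule.add_mem_iff_left _
    (Submodule.sum_mem _ fun k hk => h k (Finset.ne_of_mem_erase hk))).mp hL

/-- If all monomials of degree `j + 1` supported outside `Δ` lie in the image of multiplication by
`L`, the same holds after an elementary collapse. -/
lemma CollapseStep.monomial_mem_mulImage {K : Type} [Field K] {n d j a : ℕ}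
    {J : Ideal (MvPolynomial (Fin n) K)} {Δ Δ' : Finset (Finset (Fin n))}
    (hpow : powersIdeal K n (fun _ => a) ≤ J) (hj : d * (a - 1) ≤ j)
    (hcard : ∀ σ ∈ Δ, σ.card ≤ d + 1) (hstep : CollapseStep Δ Δ')
    (h : ∀ m : Fin n →₀ ℕ, m.degree = j + 1 → m.support ∉ Δ →
      monomial m (1 : K) ∈ mulImage J (∑ k, X k) j)
    (m : Fin n →₀ ℕ) (hm : m.degree = j + 1) (hsupp : m.support ∉ Δ') :
    monomial m (1 : K) ∈ mulImage J (∑ k, X k) j := by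
  obtain ⟨σ, τ, -, hτ, hστ, hfree, rfl⟩ := hstep
  have hlow : ∀ u : Fin n →₀ ℕ, u.degree = j + 1 → u.support.card ≤ d →
      monomial u (1 : K) ∈ mulImage J (∑ k, X k) j := fun u hu huc =>
    Submodule.mem_sup_left (hpow (monomial_mem_powersIdeal K huc (by omega)))
  have hσcard : σ.card ≤ d := by
    have := Finset.card_lt_card hστ
    have := hcard τ hτ
    omega
  obtain ⟨i, hiτ, hiσ⟩ := Finset.exists_of_ssubset hστ
  have key : ∀ (t : ℕ) (u : Fin n →₀ ℕ), u i = t → u.degree = j + 1 → u.support = τ →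
      monomial u (1 : K) ∈ mulImage J (∑ k, X k) j := by
    intro t
    induction t using Nat.strong_induction_on with
    | _ t ih =>
      intro u hut hu huτ
      have hui : u i ≠ 0 := Finsupp.mem_support_iff.mp (huτ ▸ hiτ)
      obtain ⟨w, rfl⟩ : ∃ w, u = w + Finsupp.single i 1 :=
        ⟨u - Finsupp.single i 1, (tsub_add_cancel_of_le
          (Finsupp.single_le_iff.mpr (Nat.one_le_iff_ne_zero.mpr hui))).symm⟩
      have hw : w.degree = j := by simpa using hu
      refine monomial_add_single_mem_mulImage hw i fun k hk => ?_
      have hdeg : (w + Finsupp.single k 1).degree = j + 1 := by simp [hw]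
      by_cases hΔ : (w + Finsupp.single k 1).support ∈ Δ
      · by_cases hc : (w + Finsupp.single k 1).support.card ≤ d
        · exact hlow _ hdeg hc
        have hsub : σ ⊆ (w + Finsupp.single k 1).support := by
          intro l hl
          have hli : i ≠ l := fun e => hiσ (e ▸ hl)
          have hlu : l ∈ (w + Finsupp.single i 1).support := huτ ▸ hστ.subset hl
          simp only [Finsupp.mem_support_iff, Finsupp.add_apply,
            Finsupp.single_eq_of_ne hli.symm] at hlu ⊢
          omega
        have hne : σ ≠ (w + Finsupp.single k 1).support := fun e => hc (e ▸ hσcard)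
        refine ih _ ?_ _ rfl hdeg (hfree _ hΔ (hsub.ssubset_of_ne hne))
        simp [← hut, Finsupp.single_eq_of_ne hk.symm]
      · exact h _ hdeg hΔ
  by_cases hΔ : m.support ∈ Δ
  · have hmem : m.support = σ ∨ m.support = τ := by
      by_contra hne
      exact hsupp (by simpa [hΔ] using hne)
    rcases hmem with hσ | hτ'
    · exact hlow m hm (hσ ▸ hσcard)
    · exact key _ m rfl hm hτ'
  · exact h m hm hΔ

/-- All monomials of degree greater than `d * (a - 1)` lie in the image of multiplication by
`L = ∑ k, X k` when `Δ` is collapsible. -/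
lemma Collapsible.monomial_mem_mulImage (K : Type) [Field K] {n d j a : ℕ}
    {Δ : Finset (Finset (Fin n))} (hcard : ∀ σ ∈ Δ, σ.card ≤ d + 1) (hcol : Collapsible Δ)
    (hj : d * (a - 1) ≤ j) (m : Fin n →₀ ℕ) (hm : m.degree = j + 1) :
    monomial m (1 : K) ∈
      mulImage (SRIdeal K Δ + powersIdeal K n fun _ => a) (∑ k, X k) j := by
  obtain ⟨v, hv⟩ := hcol
  have hpow : (powersIdeal K n fun _ => a) ≤ SRIdeal K Δ + powersIdeal K n fun _ => a :=
    le_sup_right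
  have hinv : ∀ Γ, Relation.ReflTransGen CollapseStep Δ Γ → Γ ⊆ Δ ∧
      ∀ m : Fin n →₀ ℕ, m.degree = j + 1 → m.support ∉ Γ →
        monomial m (1 : K) ∈
          mulImage (SRIdeal K Δ + powersIdeal K n fun _ => a) (∑ k, X k) j := by
    intro Γ hΓ
    induction hΓ with
    | refl =>
      exact ⟨subset_rfl, fun m _ hm => Submodule.mem_sup_left
        (Ideal.mem_sup_left (monomial_mem_SRIdeal K hm))⟩
    | tail _ hstep ih =>
      refine ⟨?_, hstep.monomial_mem_mulImage hpow hj (fun σ hσ => hcard σ (ih.1 hσ)) ih.2⟩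
      obtain ⟨σ, τ, -, -, -, -, rfl⟩ := hstep
      exact Finset.sdiff_subset.trans ih.1
  obtain ⟨hsub, hout⟩ := hinv _ hv
  have hlast : CollapseStep ({∅, {v}} : Finset (Finset (Fin n))) ∅ := by
    refine ⟨∅, {v}, by simp, by simp, by simp, fun η hη hne => ?_, by simp⟩
    rcases Finset.mem_insert.mp hη with rfl | hη
    · exact absurd hne (by simp)
    · exact Finset.mem_singleton.mp hη
  exact hlast.monomial_mem_mulImage hpow hj (fun σ hσ => hcard σ (hsub hσ)) hout m hm
    (Finset.notMem_empty _)


/-- **Surjectivity above degree `d(a-1)` for collapsible complexes.**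
If `Δ` is a pure collapsible `d`-dimensional complex, `a > 1`,
`J = I_Δ + (x_1^a, …, x_n^a)` and `L = x_1 + ⋯ + x_n`, then
`×L : (R/J)_j → (R/J)_{j+1}` is surjective for every `j ≥ d(a-1)`. -/
theorem collapsible_multiplication_surjective (K : Type) [Field K] [CharZero K]
    {n d a : ℕ} (Δ : Finset (Finset (Fin n)))
    (hcomplex : IsComplex Δ) (hdim : HasDim Δ d)
    (hpure : IsPure Δ d) (hcol : Collapsible Δ) (ha : 1 < a) :
    ∀ j : ℕ, d * (a - 1) ≤ j →
      ∀ y ∈ quotComponent K (SRIdeal K Δ + powersIdeal K n fun _ => a) (j + 1),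
        ∃ x ∈ quotComponent K (SRIdeal K Δ + powersIdeal K n fun _ => a) j,
          Ideal.Quotient.mk (SRIdeal K Δ + powersIdeal K n fun _ => a)
            (∑ i, X i) * x = y := by
  rintro j hj _ ⟨p, hp, rfl⟩
  have hmem : p ∈ mulImage (SRIdeal K Δ + powersIdeal K n fun _ => a) (∑ k, X k) j := by
    rw [p.as_sum]
    refine Submodule.sum_mem _ fun m hm => ?_
    have hdeg : m.degree = j + 1 := by
      rw [Finsupp.degree_eq_weight_one]
      exact hp (mem_support_iff.mp hm)
    rw [← mul_one (coeff m p), ← smul_eq_mul, ← smul_monomial]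
    exact Submodule.smul_mem _ _ (hcol.monomial_mem_mulImage K hdim.1 hj m hdeg)
  obtain ⟨q, hq, _, ⟨r, hr, rfl⟩, hqr⟩ := Submodule.mem_sup.mp hmem
  refine ⟨_, ⟨r, hr, rfl⟩, ?_⟩
  change Ideal.Quotient.mk _ _ * Ideal.Quotient.mk _ r = Ideal.Quotient.mk _ p
  rw [← hqr, map_add, Ideal.Quotient.eq_zero_iff_mem (a := q) |>.mpr hq, zero_add, ← map_mul]
  rfl
end

section
/- Let K be a field of characteristic zero, let Δ be a pure, collapsible d-dimensional simplicial complex on vertex set [n], and fix an integer a > 0. Then for every integer t > d(a−1), Δ does not admit an a-unexpected system of parameters of total degree t; that is, there is no sequence θ_1,…,θ_{d+1} of homogeneous elements of R = K[x_1,…,x_n] satisfying conditions (U1)–(U5). -/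
open MvPolynomial
open scoped Classical

/-- `θ_1, …, θ_{d+1}` is an `(L, a)`-unexpected system of parameters of `Δ` of
total degree `t`, where `θ i` is homogeneous of degree `deg i`:
(U1) it is a homogeneous system of parameters of `I_Δ` (with positive degrees)
which is a regular sequence on `R/I_Δ`;
(U2) `deg θ_1 + ⋯ + deg θ_{d+1} + deg h_Δ - d - 1 = t`;
(U3) `x_1 + ⋯ + x_n` lies in `I_Δ + (θ_1, …, θ_{d+1})`;
(U4) `x_i^a ∈ I_Δ + (θ_1, …, θ_{d+1})` for every `i`;
(U5) `dim_K (R/J)_t ≤ dim_K (R/J)_{t-1}` where `J = I_Δ + (x_1^a, …, x_n^a)`. -/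
def IsUnexpectedSOP (K : Type) [Field K] {n : ℕ} (Δ : Finset (Finset (Fin n)))
    (d a t : ℕ) (θ : Fin (d + 1) → MvPolynomial (Fin n) K)
    (deg : Fin (d + 1) → ℕ) : Prop :=
  (∀ i, 0 < deg i) ∧ (∀ i, (θ i).IsHomogeneous (deg i)) ∧
  FiniteDimensional K
    (MvPolynomial (Fin n) K ⧸ (SRIdeal K Δ + Ideal.span (Set.range θ))) ∧
  RingTheory.Sequence.IsRegular (MvPolynomial (Fin n) K ⧸ SRIdeal K Δ) (List.ofFn θ) ∧
  (∑ i, deg i) + (hPoly Δ d).natDegree = t + d + 1 ∧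
  (∑ i, X i) ∈ SRIdeal K Δ + Ideal.span (Set.range θ) ∧
  (∀ i : Fin n, (X i : MvPolynomial (Fin n) K) ^ a ∈ SRIdeal K Δ + Ideal.span (Set.range θ)) ∧
  quotDim K (SRIdeal K Δ + powersIdeal K n fun _ => a) t ≤
    quotDim K (SRIdeal K Δ + powersIdeal K n fun _ => a) (t - 1)
theorem CollapseStep.downClosed {n : ℕ} {Δ Δ' : Finset (Finset (Fin n))}
    (h : CollapseStep Δ Δ') (hΔ : ∀ σ ∈ Δ, ∀ τ, τ ⊆ σ → τ ∈ Δ) :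
    ∀ σ ∈ Δ', ∀ τ, τ ⊆ σ → τ ∈ Δ' := by
  obtain ⟨σ, τ, hσ, hτ, hστ, huniq, rfl⟩ := h
  intro η hη ρ hρ
  simp only [Finset.mem_sdiff, Finset.mem_insert, Finset.mem_singleton, not_or] at hη ⊢
  obtain ⟨hηΔ, hησ, hητ⟩ := hη
  refine ⟨hΔ η hηΔ ρ hρ, ?_, ?_⟩
  · rintro rfl
    exact hητ (huniq η hηΔ (hρ.ssubset_of_ne (Ne.symm hησ)))
  · rintro rfl
    exact hητ (huniq η hηΔ (hστ.trans_subset hρ))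

/-- A monomial of degree larger than `d (a - 1)` with at most `d` variables in its support
has an exponent that is at least `a`. -/
theorem exists_le_apply_of_card_support_le {n d a : ℕ} (m : Fin n →₀ ℕ)
    (hm : d * (a - 1) < m.degree) (hcard : m.support.card ≤ d) : ∃ i, a ≤ m i := by
  by_contra! hlt
  have h1 : m.degree ≤ m.support.card * (a - 1) := by
    rw [Finsupp.degree_apply]
    exact Finset.sum_le_card_nsmul _ _ _ fun i _ => by have := hlt i; omega
  have h2 := Nat.mul_le_mul_right (a - 1) hcard
  omega

section Functional

variable {K : Type} [Field K] {n d a t : ℕ} {Δ : Finset (Finset (Fin n))}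
  {c : (Fin n →₀ ℕ) → K}

/-- Elimination along one free face: `v` is the vertex of the facet `τ` opposite to
a free face. -/
theorem vanish_on_face_of_free (ht : d * (a - 1) < t)
    (hpow : ∀ m i, a ≤ m i → c m = 0)
    (hlin : ∀ m, ∑ i, c (m + Finsupp.single i 1) = 0)
    {τ : Finset (Fin n)} (hτ : τ.card = d + 1) {v : Fin n} (hv : v ∈ τ)
    (hout : ∀ m : Fin n →₀ ℕ, m.degree = t → τ.erase v ⊆ m.support →
      ¬ m.support ⊆ τ → c m = 0) :
    ∀ k, ∀ m : Fin n →₀ ℕ, m v = k → m.degree = t → m.support ⊆ τ → c m = 0 := by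
  have hsmall : ∀ m : Fin n →₀ ℕ, m.degree = t → m.support.card ≤ d → c m = 0 := by
    intro m hm hcard
    obtain ⟨i, hi⟩ := exists_le_apply_of_card_support_le (a := a) m (hm ▸ ht) hcard
    exact hpow m i hi
  intro k
  induction k with
  | zero =>
    intro m hmv hdeg hsupp
    refine hsmall m hdeg ?_
    have hsub : m.support ⊆ τ.erase v := fun i hi =>
      Finset.mem_erase.2 ⟨fun h => by simp [h, hmv] at hi, hsupp hi⟩
    have := Finset.card_le_card hsub
    rw [Finset.card_erase_of_mem hv] at this
    omega
  | succ k ih =>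
    intro m hmv hdeg hsupp
    by_cases hfull : m.support = τ
    swap
    · have := Finset.card_lt_card (hsupp.ssubset_of_ne hfull)
      exact hsmall m hdeg (by omega)
    obtain ⟨m', rfl⟩ : ∃ m', m = m' + Finsupp.single v 1 :=
      ⟨m - Finsupp.single v 1, by
        rw [tsub_add_cancel_of_le]
        exact Finsupp.single_le_iff.2 (by omega)⟩
    have hm'v : m' v = k := by simpa using hmv
    have hdeg' : ∀ w, (m' + Finsupp.single w 1).degree = t := by
      intro w
      rw [← hdeg]
      simp
    have hm'τ : m'.support ⊆ τ := by
      refine subset_trans (fun i hi => ?_) hsupp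
      simp only [Finsupp.mem_support_iff, Finsupp.add_apply] at hi ⊢
      omega
    rw [← hlin m']
    symm
    refine Finset.sum_eq_single v (fun w _ hw => ?_) (by simp)
    by_cases hwτ : w ∈ τ
    · refine ih _ (by simp [hm'v, hw]) (hdeg' w) ?_
      refine Finsupp.support_add.trans (Finset.union_subset hm'τ ?_)
      exact Finsupp.support_single_subset.trans (by simpa using hwτ)
    · refine hout _ (hdeg' w) (fun i hi => ?_) fun h => hwτ (h ?_)
      · obtain ⟨hiv, hi⟩ := Finset.mem_erase.1 hi
        rw [← hfull] at hi
        simp only [Finsupp.mem_support_iff, Finsupp.add_apply,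
          Finsupp.single_eq_of_ne hiv] at hi ⊢
        omega
      · simp

/-- Vanishing on the faces removed so far is propagated by a collapse. -/
theorem vanish_of_collapseStep (hdim : ∀ σ ∈ Δ, σ.card ≤ d + 1) (ht : d * (a - 1) < t)
    (hpow : ∀ m i, a ≤ m i → c m = 0)
    (hlin : ∀ m, ∑ i, c (m + Finsupp.single i 1) = 0)
    {Γ Γ' : Finset (Finset (Fin n))} (hΓΔ : Γ ⊆ Δ)
    (hΓ : ∀ σ ∈ Γ, ∀ τ, τ ⊆ σ → τ ∈ Γ) (hstep : CollapseStep Γ Γ')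
    (hvan : ∀ m : Fin n →₀ ℕ, m.degree = t → m.support ∉ Γ → c m = 0) :
    ∀ m : Fin n →₀ ℕ, m.degree = t → m.support ∉ Γ' → c m = 0 := by
  obtain ⟨σ, τ, hσ, hτ, hστ, huniq, rfl⟩ := hstep
  intro m hdeg hm
  by_cases hcard : m.support.card ≤ d
  · obtain ⟨i, hi⟩ := exists_le_apply_of_card_support_le (a := a) m (hdeg ▸ ht) hcard
    exact hpow m i hi
  by_cases hmΓ : m.support ∈ Γ
  swap
  · exact hvan m hdeg hmΓ
  have hτcard := hdim τ (hΓΔ hτ)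
  have hσcard := Finset.card_lt_card hστ
  have hmτ : m.support = τ := by
    simp only [Finset.mem_sdiff, Finset.mem_insert, Finset.mem_singleton] at hm
    rcases not_not.1 (fun h => hm ⟨hmΓ, h⟩) with h | h
    · rw [h] at hcard
      omega
    · exact h
  obtain ⟨v, hvτ, hvσ⟩ := Finset.exists_of_ssubset hστ
  have hins : insert v σ = τ := by
    have hsub : insert v σ ⊆ τ := Finset.insert_subset hvτ hστ.subset
    exact huniq _ (hΓ τ hτ _ hsub) (Finset.ssubset_insert hvσ)
  have herase : τ.erase v = σ := by rw [← hins, Finset.erase_insert hvσ]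
  rw [hmτ] at hcard
  refine vanish_on_face_of_free ht hpow hlin (by omega) hvτ ?_ _ m rfl hdeg hmτ.subset
  intro m' hdeg' hsub hnot
  rw [herase] at hsub
  refine hvan m' hdeg' fun hmem => hnot ?_
  rcases hsub.eq_or_ssubset with h | h
  · exact h ▸ hστ.subset
  · exact (huniq _ hmem h).subset

theorem vanish_of_collapsible (hcomplex : IsComplex Δ) (hdim : ∀ σ ∈ Δ, σ.card ≤ d + 1)
    (hcol : Collapsible Δ) (ht : d * (a - 1) < t)
    (hface : ∀ m, m.support ∉ Δ → c m = 0) (hpow : ∀ m i, a ≤ m i → c m = 0)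
    (hlin : ∀ m, ∑ i, c (m + Finsupp.single i 1) = 0) (m : Fin n →₀ ℕ)
    (hm : m.degree = t) : c m = 0 := by
  obtain ⟨v, hv⟩ := hcol
  have hlast : CollapseStep {∅, {v}} (∅ : Finset (Finset (Fin n))) :=
    ⟨∅, {v}, by simp, by simp, by simp, by
      intro η hη hne
      simp only [Finset.mem_insert, Finset.mem_singleton] at hη
      exact hη.resolve_left hne.ne', by simp⟩
  have key : ∀ Γ, Relation.ReflTransGen CollapseStep Δ Γ → Γ ⊆ Δ ∧
      (∀ σ ∈ Γ, ∀ τ, τ ⊆ σ → τ ∈ Γ) ∧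
      ∀ m : Fin n →₀ ℕ, m.degree = t → m.support ∉ Γ → c m = 0 := by
    intro Γ hΓ
    induction hΓ with
    | refl => exact ⟨subset_rfl, hcomplex.2, fun m _ => hface m⟩
    | tail _ hstep ih =>
      obtain ⟨hsub, hdown, hvan⟩ := ih
      refine ⟨?_, hstep.downClosed hdown,
        vanish_of_collapseStep hdim ht hpow hlin hsub hdown hstep hvan⟩
      obtain ⟨σ, τ, -, -, -, -, rfl⟩ := hstep
      exact Finset.sdiff_subset.trans hsub
  exact (key ∅ (hv.tail hlast)).2.2 m hm (Finset.notMem_empty _)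

end Functional

theorem degree_eq_of_mem_support {K : Type} [Field K] {n t : ℕ} {f : MvPolynomial (Fin n) K}
    (hf : f.IsHomogeneous t) {m : Fin n →₀ ℕ} (hm : m ∈ f.support) : m.degree = t := by
  rw [Finsupp.degree_eq_weight_one]
  exact hf (mem_support_iff.1 hm)

/-- For a collapsible complex, every form of degree `t > d (a - 1)` lies in an ideal containing
the Stanley–Reisner ideal, the `a`-th powers of the variables and their sum. -/
theorem mem_of_collapsible {K : Type} [Field K] {n d a t : ℕ} {Δ : Finset (Finset (Fin n))}
    (hcomplex : IsComplex Δ) (hdim : ∀ σ ∈ Δ, σ.card ≤ d + 1)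
    (hcol : Collapsible Δ) (ht : d * (a - 1) < t) {I : Ideal (MvPolynomial (Fin n) K)}
    (hSR : SRIdeal K Δ ≤ I) (hpow : ∀ i, (X i : MvPolynomial (Fin n) K) ^ a ∈ I)
    (hlin : ∑ i, X i ∈ I) {f : MvPolynomial (Fin n) K} (hf : f.IsHomogeneous t) : f ∈ I := by
  by_contra hfI
  obtain ⟨φ, hφf, hφI⟩ := Submodule.exists_le_ker_of_notMem
    (p := I.restrictScalars K) (v := f) hfI
  have hker : ∀ g ∈ I, φ g = 0 := fun g hg => hφI hg
  have hvan := vanish_of_collapsible (c := fun m => φ (monomial m 1)) hcomplex hdim hcol ht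
    ?_ ?_ ?_
  · apply hφf
    rw [f.as_sum, map_sum]
    refine Finset.sum_eq_zero fun m hm => ?_
    have : monomial m (coeff m f) = coeff m f • (monomial m 1 : MvPolynomial (Fin n) K) := by
      simp [smul_monomial]
    rw [this, map_smul, hvan m (degree_eq_of_mem_support hf hm), smul_zero]
  · intro m hm
    refine hker _ (hSR ?_)
    have hdvd : ∏ i ∈ m.support, (X i : MvPolynomial (Fin n) K) ∣ monomial m 1 := by
      rw [monomial_eq, C_1, one_mul, Finsupp.prod]
      exact Finset.prod_dvd_prod_of_dvd _ _ fun i hi =>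
        dvd_pow_self _ (Finsupp.mem_support_iff.1 hi)
    exact Ideal.mem_of_dvd _ hdvd (Ideal.subset_span ⟨_, hm, rfl⟩)
  · intro m i hi
    refine hker _ (Ideal.mem_of_dvd _ ?_ (hpow i))
    rw [X_pow_eq_monomial, monomial_dvd_monomial]
    exact ⟨Or.inr (Finsupp.single_le_iff.2 hi), one_dvd _⟩
  · intro m
    rw [← map_sum]
    refine hker _ ?_
    have : ∑ i, (monomial (m + Finsupp.single i 1) 1 : MvPolynomial (Fin n) K) =
        monomial m 1 * ∑ i, X i := by
      rw [Finset.mul_sum]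
      exact Finset.sum_congr rfl fun i _ => by rw [X, monomial_mul, one_mul]
    rw [this]
    exact I.mul_mem_left _ hlin

section Hilbert

variable {K : Type} [Field K] {n : ℕ}

theorem homogeneousSubmodule_eq_span_monomial (s : ℕ) :
    homogeneousSubmodule (Fin n) K s =
      Submodule.span K ((fun m => monomial m (1 : K)) ''
        (Finset.finsuppAntidiag (Finset.univ : Finset (Fin n)) s : Set (Fin n →₀ ℕ))) := by
  apply le_antisymm
  · intro f hf
    rw [f.as_sum]
    refine Submodule.sum_mem _ fun m hm => ?_
    have : monomial m (coeff m f) = coeff m f • (monomial m 1 : MvPolynomial (Fin n) K) := by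
      simp [smul_monomial]
    rw [this]
    refine Submodule.smul_mem _ _ (Submodule.subset_span ⟨m, ?_, rfl⟩)
    have hdeg : m.degree = s :=
      degree_eq_of_mem_support ((mem_homogeneousSubmodule _ _).1 hf) hm
    simpa [Finset.mem_finsuppAntidiag, Finsupp.degree_eq_sum] using hdeg
  · rw [Submodule.span_le]
    rintro _ ⟨m, hm, rfl⟩
    rw [SetLike.mem_coe, mem_homogeneousSubmodule]
    refine isHomogeneous_monomial _ ?_
    simpa [Finset.mem_finsuppAntidiag, Finsupp.degree_eq_sum] using hm

instance finiteDimensional_homogeneousSubmodule (s : ℕ) :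
    FiniteDimensional K (homogeneousSubmodule (Fin n) K s) := by
  rw [homogeneousSubmodule_eq_span_monomial]
  exact FiniteDimensional.span_of_finite K (Set.toFinite _)

theorem mem_quotComponent {J : Ideal (MvPolynomial (Fin n) K)} {s : ℕ}
    {x : MvPolynomial (Fin n) K ⧸ J} :
    x ∈ quotComponent K J s ↔
      ∃ f : MvPolynomial (Fin n) K, f.IsHomogeneous s ∧ Ideal.Quotient.mk J f = x :=
  Iff.rfl

instance finiteDimensional_quotComponent (J : Ideal (MvPolynomial (Fin n) K)) (s : ℕ) :
    FiniteDimensional K (quotComponent K J s) := by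
  unfold quotComponent
  infer_instance

/-- Membership in a Stanley–Reisner ideal is decided by the supports of the monomials. -/
theorem mem_SRIdeal_iff {Δ : Finset (Finset (Fin n))} (hΔ : IsComplex Δ)
    {f : MvPolynomial (Fin n) K} :
    f ∈ SRIdeal K Δ ↔ ∀ m ∈ f.support, m.support ∉ Δ := by
  have hgen : {m : MvPolynomial (Fin n) K | ∃ σ : Finset (Fin n), σ ∉ Δ ∧ m = ∏ i ∈ σ, X i} =
      (fun m => monomial m (1 : K)) ''
        ((fun σ : Finset (Fin n) => ∑ i ∈ σ, Finsupp.single i 1) '' {σ | σ ∉ Δ}) := by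
    have hmon (σ : Finset (Fin n)) : monomial (∑ i ∈ σ, Finsupp.single i 1) (1 : K) =
        ∏ i ∈ σ, X i := by
      rw [monomial_sum_one]
      rfl
    ext p
    simp only [Set.mem_ofPred_eq, Set.mem_image, exists_exists_and_eq_and, hmon, eq_comm (a := p)]
  have hle (σ : Finset (Fin n)) (m : Fin n →₀ ℕ) :
      (∑ i ∈ σ, Finsupp.single i 1 : Fin n →₀ ℕ) ≤ m ↔ σ ⊆ m.support := by
    have happ (j : Fin n) : (∑ i ∈ σ, Finsupp.single i 1 : Fin n →₀ ℕ) j =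
        if j ∈ σ then 1 else 0 := by
      simp [Finsupp.finsetSum_apply, Finsupp.single_apply]
    constructor
    · intro h j hj
      have := h j
      rw [happ, if_pos hj] at this
      simp
      omega
    · intro h j
      rw [happ]
      split_ifs with hj
      · have := Finsupp.mem_support_iff.1 (h hj)
        omega
      · omega
  rw [SRIdeal, hgen, mem_ideal_span_monomial_image]
  refine forall₂_congr fun m _ => ?_
  simp only [Set.mem_image, Set.mem_ofPred_eq, exists_exists_and_eq_and, hle]
  exact ⟨fun ⟨σ, hσ, hsub⟩ hm => hσ (hΔ.2 _ hm _ hsub), fun h => ⟨_, h, subset_rfl⟩⟩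

theorem quotDim_SRIdeal {Δ : Finset (Finset (Fin n))} (hΔ : IsComplex Δ) (s : ℕ) :
    quotDim K (SRIdeal K Δ) s =
      ((Finset.finsuppAntidiag (Finset.univ : Finset (Fin n)) s).filter
        fun m => m.support ∈ Δ).card := by
  set S := (Finset.finsuppAntidiag (Finset.univ : Finset (Fin n)) s).filter
    fun m => m.support ∈ Δ with hS
  let π := (Ideal.Quotient.mkₐ K (SRIdeal K Δ)).toLinearMap
  have hmem (m : Fin n →₀ ℕ) (hm : m ∈ S) : m.support ∈ Δ := (Finset.mem_filter.1 hm).2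
  have hspan : quotComponent K (SRIdeal K Δ) s =
      Submodule.span K (Set.range fun m : S => π (monomial m.1 1)) := by
    rw [quotComponent, homogeneousSubmodule_eq_span_monomial, Submodule.map_span]
    apply le_antisymm <;> rw [Submodule.span_le]
    · rintro _ ⟨_, ⟨m, hm, rfl⟩, rfl⟩
      by_cases hmΔ : m.support ∈ Δ
      · exact Submodule.subset_span ⟨⟨m, Finset.mem_filter.2 ⟨hm, hmΔ⟩⟩, rfl⟩
      · have : π (monomial m 1) = 0 := by
          refine Ideal.Quotient.eq_zero_iff_mem.2 ((mem_SRIdeal_iff hΔ).2 fun m' hm' => ?_)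
          rwa [Finset.mem_singleton.1 (support_monomial_subset hm')]
        exact this ▸ Submodule.zero_mem _
    · rintro _ ⟨m, rfl⟩
      exact Submodule.subset_span ⟨_, ⟨m.1, (Finset.mem_filter.1 m.2).1, rfl⟩, rfl⟩
  have hind : LinearIndependent K fun m : S => π (monomial m.1 1) := by
    rw [Fintype.linearIndependent_iff]
    intro g hg m
    have hg' : ∑ m : S, g m • monomial m.1 (1 : K) ∈ SRIdeal K Δ := by
      refine Ideal.Quotient.eq_zero_iff_mem.1 ?_
      have : π (∑ m : S, g m • monomial m.1 (1 : K)) = 0 := by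
        simpa only [map_sum, map_smul] using hg
      exact this
    have hcoeff : coeff m.1 (∑ m : S, g m • monomial m.1 (1 : K)) = g m := by
      simp [coeff_sum, coeff_monomial]
    by_contra hne
    refine (mem_SRIdeal_iff hΔ).1 hg' m.1 ?_ (hmem _ m.2)
    rw [mem_support_iff, hcoeff]
    exact hne
  rw [quotDim, hspan, finrank_span_eq_card hind, Fintype.card_coe]

/-- The Hilbert series of `R/J`. -/
noncomputable def hilbertSeries (K : Type) [Field K] {n : ℕ}
    (J : Ideal (MvPolynomial (Fin n) K)) : PowerSeries ℤ :=
  PowerSeries.mk fun s => (quotDim K J s : ℤ)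

theorem card_filter_support_eq (σ : Finset (Fin n)) (s : ℕ) :
    ((((Finset.finsuppAntidiag (Finset.univ : Finset (Fin n)) s).filter
        fun m => m.support = σ).card : ℕ) : ℤ) =
      PowerSeries.coeff s ((PowerSeries.X * PowerSeries.mk 1 : PowerSeries ℤ) ^ σ.card) := by
  have hc (k : ℕ) : PowerSeries.coeff k (PowerSeries.X * PowerSeries.mk 1 : PowerSeries ℤ) =
      if k = 0 then 0 else 1 := by
    cases k <;> simp [PowerSeries.coeff_succ_X_mul]
  rw [← Finset.prod_const, PowerSeries.coeff_prod, Finset.card_filter,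
    Nat.cast_sum]
  have hsub : Finset.finsuppAntidiag σ s ⊆ Finset.finsuppAntidiag Finset.univ s :=
    Finset.finsuppAntidiag_mono (Finset.subset_univ σ) s
  symm
  have hfull : ∀ m ∈ Finset.finsuppAntidiag σ s,
      ∏ i ∈ σ, PowerSeries.coeff (m i) (PowerSeries.X * PowerSeries.mk 1 : PowerSeries ℤ) =
        ((if m.support = σ then 1 else 0 : ℕ) : ℤ) := by
    intro m hm
    have hmσ := (Finset.mem_finsuppAntidiag.1 hm).2
    simp only [hc]
    split_ifs with h
    · subst h
      rw [Nat.cast_one]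
      exact Finset.prod_eq_one fun i hi => if_neg (Finsupp.mem_support_iff.1 hi)
    · obtain ⟨i, hi, him⟩ := Finset.exists_of_ssubset (hmσ.ssubset_of_ne h)
      rw [Nat.cast_zero]
      exact Finset.prod_eq_zero hi (if_pos (Finsupp.notMem_support_iff.1 him))
  rw [Finset.sum_congr rfl hfull]
  refine Finset.sum_subset hsub fun m hm hmσ => ?_
  have : m.support ≠ σ := by
    rintro rfl
    refine hmσ (Finset.mem_finsuppAntidiag.2 ⟨?_, subset_rfl⟩)
    rw [← (Finset.mem_finsuppAntidiag.1 hm).1]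
    exact Finset.sum_subset (Finset.subset_univ _) fun i _ hi => Finsupp.notMem_support_iff.1 hi
  simp [this]

theorem hilbertSeries_SRIdeal {Δ : Finset (Finset (Fin n))} (hΔ : IsComplex Δ) :
    hilbertSeries K (SRIdeal K Δ) =
      ∑ σ ∈ Δ, (PowerSeries.X * PowerSeries.mk 1 : PowerSeries ℤ) ^ σ.card := by
  ext s
  have hmaps : Set.MapsTo (fun m : Fin n →₀ ℕ => m.support)
      ((Finset.finsuppAntidiag (Finset.univ : Finset (Fin n)) s).filter
        fun m => m.support ∈ Δ : Finset (Fin n →₀ ℕ)) Δ :=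
    fun m hm => (Finset.mem_filter.1 hm).2
  rw [hilbertSeries, PowerSeries.coeff_mk, quotDim_SRIdeal hΔ, map_sum,
    Finset.card_eq_sum_card_fiberwise hmaps, Nat.cast_sum]
  refine Finset.sum_congr rfl fun σ hσ => ?_
  rw [← card_filter_support_eq, Finset.filter_filter]
  congr 2
  ext m
  simp only [Finset.mem_filter]
  exact ⟨fun h => ⟨h.1, h.2.2⟩, fun h => ⟨h.1, h.2 ▸ hσ, h.2⟩⟩

theorem hPoly_eq_sum {Δ : Finset (Finset (Fin n))} {d : ℕ} (hdim : ∀ σ ∈ Δ, σ.card ≤ d + 1) :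
    hPoly Δ d =
      ∑ σ ∈ Δ, Polynomial.X ^ σ.card * (1 - Polynomial.X) ^ (d + 1 - σ.card) := by
  have hsum {ι : Type} (S : Finset ι) (f : ι → Polynomial ℤ) (N : ℕ) :
      Polynomial.reflect N (∑ i ∈ S, f i) = ∑ i ∈ S, Polynomial.reflect N (f i) := by
    induction S using Finset.induction_on with
    | empty => simp
    | insert i S hi ih => rw [Finset.sum_insert hi, Finset.sum_insert hi, Polynomial.reflect_add, ih]
  have hX1 : (Polynomial.X - 1 : Polynomial ℤ).natDegree = 1 := by
    rw [← Polynomial.C_1, Polynomial.natDegree_X_sub_C]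
  have hlin : Polynomial.reflect 1 (Polynomial.X - 1 : Polynomial ℤ) = 1 - Polynomial.X := by
    have h1 : Polynomial.reflect 1 (Polynomial.X : Polynomial ℤ) = 1 := by
      simp
    rw [Polynomial.reflect_sub, h1, Polynomial.reflect_one, pow_one]
  have hpow (k : ℕ) : Polynomial.reflect k ((Polynomial.X - 1 : Polynomial ℤ) ^ k) =
      (1 - Polynomial.X) ^ k := by
    induction k with
    | zero => simp
    | succ k ih =>
      rw [pow_succ, Polynomial.reflect_mul _ _ (Polynomial.natDegree_pow_le_of_le k hX1.le |>.trans
        (by simp)) hX1.le, ih, hlin, pow_succ]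
  have hterm (i : ℕ) (hi : i ≤ d + 1) :
      Polynomial.reflect (d + 1) ((Polynomial.X - 1 : Polynomial ℤ) ^ (d + 1 - i)) =
        Polynomial.X ^ i * (1 - Polynomial.X) ^ (d + 1 - i) := by
    have h := Polynomial.reflect_mul (1 : Polynomial ℤ) ((Polynomial.X - 1) ^ (d + 1 - i))
      (F := i) (G := d + 1 - i) (by simp)
      (Polynomial.natDegree_pow_le_of_le (d + 1 - i) hX1.le |>.trans (by simp))
    rwa [one_mul, Nat.add_sub_cancel' hi, Polynomial.reflect_one, hpow] at h
  rw [hPoly, hsum, ← Finset.sum_fiberwise_of_maps_to (g := Finset.card) (t := Finset.range (d + 2))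
    (fun σ hσ => Finset.mem_range.2 (Nat.lt_succ_of_le (hdim σ hσ)))]
  refine Finset.sum_congr rfl fun i hi => ?_
  have hi' : i ≤ d + 1 := Nat.lt_succ_iff.1 (Finset.mem_range.1 hi)
  rw [← Polynomial.C_mul', Polynomial.reflect_C_mul, hterm i hi',
    Finset.sum_congr rfl (g := fun _ => Polynomial.X ^ i * (1 - Polynomial.X) ^ (d + 1 - i))
      (fun σ hσ => by rw [(Finset.mem_filter.1 hσ).2]), Finset.sum_const, faceCount]
  simp

theorem hilbertSeries_SRIdeal_mul {Δ : Finset (Finset (Fin n))} (hΔ : IsComplex Δ) {d : ℕ}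
    (hdim : ∀ σ ∈ Δ, σ.card ≤ d + 1) :
    hilbertSeries K (SRIdeal K Δ) * (1 - PowerSeries.X) ^ (d + 1) =
      ((hPoly Δ d : Polynomial ℤ) : PowerSeries ℤ) := by
  rw [hilbertSeries_SRIdeal hΔ, hPoly_eq_sum hdim, Finset.sum_mul,
    ← Polynomial.coeToPowerSeries.ringHom_apply, map_sum]
  refine Finset.sum_congr rfl fun σ hσ => ?_
  simp only [map_mul, map_pow, map_sub, map_one, Polynomial.coeToPowerSeries.ringHom_apply,
    Polynomial.coe_X]
  have hsplit : (1 - PowerSeries.X : PowerSeries ℤ) ^ (d + 1) =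
      (1 - PowerSeries.X) ^ σ.card * (1 - PowerSeries.X) ^ (d + 1 - σ.card) := by
    rw [← pow_add, Nat.add_sub_cancel' (hdim σ hσ)]
  rw [hsplit, ← mul_assoc, ← mul_pow, mul_assoc PowerSeries.X,
    PowerSeries.mk_one_mul_one_sub_eq_one, mul_one]

theorem hPoly_ne_zero {Δ : Finset (Finset (Fin n))} (hΔ : IsComplex Δ) {d : ℕ}
    (hdim : ∀ σ ∈ Δ, σ.card ≤ d + 1) : hPoly Δ d ≠ 0 := by
  intro h
  have := congrArg (Polynomial.eval 0) h
  rw [hPoly_eq_sum hdim, Polynomial.eval_finsetSum, Finset.sum_eq_single ∅] at this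
  · simp at this
  · intro σ _ hσ
    simp [hσ]
  · exact fun h => absurd hΔ.1 h

end Hilbert

section RegularSequence

variable {K : Type} [Field K] {n : ℕ}

attribute [local instance] MvPolynomial.gradedAlgebra

theorem homogeneousComponent_mul_left {θ : MvPolynomial (Fin n) K} {e : ℕ}
    (hθ : θ.IsHomogeneous e) (g : MvPolynomial (Fin n) K) (s : ℕ) :
    homogeneousComponent s (θ * g) =
      if e ≤ s then θ * homogeneousComponent (s - e) g else 0 := by
  have h := DirectSum.coe_decompose_mul_of_left_mem (homogeneousSubmodule (Fin n) K)
    (b := g) s ((mem_homogeneousSubmodule _ _).2 hθ)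
  simp only [← decomposition.decompose'_apply]
  exact h

theorem exists_homogeneous_of_mem_sup_span {I : Ideal (MvPolynomial (Fin n) K)}
    (hI : I.IsHomogeneous (homogeneousSubmodule (Fin n) K)) {θ f : MvPolynomial (Fin n) K}
    {e s : ℕ} (hθ : θ.IsHomogeneous e) (hf : f.IsHomogeneous s)
    (hmem : f ∈ I ⊔ Ideal.span {θ}) :
    ∃ g : MvPolynomial (Fin n) K,
      f - (if e ≤ s then θ * homogeneousComponent (s - e) g else 0) ∈ I := by
  obtain ⟨p, hp, q, hq, rfl⟩ := Submodule.mem_sup.1 hmem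
  obtain ⟨g, rfl⟩ := Ideal.mem_span_singleton'.1 hq
  refine ⟨g, ?_⟩
  rw [← homogeneousComponent_mul_left hθ]
  have hcomp : homogeneousComponent s (p + g * θ) = p + g * θ := by
    rw [homogeneousComponent_of_mem ((mem_homogeneousSubmodule _ _).2 hf), if_pos rfl]
  rw [← hcomp, map_add, mul_comm g, add_sub_cancel_right]
  exact homogeneousComponent_mem_of_mem hI hp s

/-- Dividing out a form `θ` that is regular on `R/I` splits off a shifted copy of `R/I`. -/
theorem quotDim_sup_span {I : Ideal (MvPolynomial (Fin n) K)}
    (hI : I.IsHomogeneous (homogeneousSubmodule (Fin n) K)) {θ : MvPolynomial (Fin n) K}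
    {e : ℕ} (hθ : θ.IsHomogeneous e) (hreg : ∀ f, θ * f ∈ I → f ∈ I) (s : ℕ) :
    quotDim K I s =
      quotDim K (I ⊔ Ideal.span {θ}) s + if e ≤ s then quotDim K I (s - e) else 0 := by
  let φ := (Ideal.Quotient.factorₐ K (le_sup_left : I ≤ I ⊔ Ideal.span {θ})).toLinearMap
  let μ := LinearMap.mulLeft K (Ideal.Quotient.mk I θ)
  have hμ : Function.Injective μ := by
    rw [← LinearMap.ker_eq_bot, LinearMap.ker_eq_bot']
    intro x hx
    obtain ⟨f, rfl⟩ := Ideal.Quotient.mk_surjective x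
    rw [LinearMap.mulLeft_apply, ← map_mul, Ideal.Quotient.eq_zero_iff_mem] at hx
    exact Ideal.Quotient.eq_zero_iff_mem.2 (hreg f hx)
  have hrange : (φ.domRestrict (quotComponent K I s)).range =
      quotComponent K (I ⊔ Ideal.span {θ}) s := by
    rw [LinearMap.range_domRestrict, quotComponent, quotComponent, ← Submodule.map_comp]
    rfl
  have hker : (φ.domRestrict (quotComponent K I s)).ker.map (quotComponent K I s).subtype =
      if e ≤ s then (quotComponent K I (s - e)).map μ else ⊥ := by
    apply le_antisymm
    · rintro _ ⟨⟨x, hx⟩, hxker, rfl⟩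
      obtain ⟨f, hf, rfl⟩ := mem_quotComponent.1 hx
      have hfmem : f ∈ I ⊔ Ideal.span {θ} := Ideal.Quotient.eq_zero_iff_mem.1 hxker
      obtain ⟨g, hg⟩ := exists_homogeneous_of_mem_sup_span hI hθ hf hfmem
      rw [← Ideal.Quotient.mk_eq_mk_iff_sub_mem] at hg
      simp only [Submodule.subtype_apply]
      rw [hg]
      split_ifs
      · exact ⟨_, mem_quotComponent.2 ⟨_, homogeneousComponent_isHomogeneous (s - e) g, rfl⟩,
          (map_mul _ _ _).symm⟩
      · simp
    · split_ifs with hes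
      · rintro _ ⟨x, hx, rfl⟩
        obtain ⟨g, hg, rfl⟩ := mem_quotComponent.1 hx
        have hθg : (θ * g).IsHomogeneous s := by
          simpa [Nat.add_sub_cancel' hes] using hθ.mul hg
        refine ⟨⟨Ideal.Quotient.mk I (θ * g), mem_quotComponent.2 ⟨_, hθg, rfl⟩⟩, ?_,
          map_mul (Ideal.Quotient.mk I) θ g⟩
        refine Ideal.Quotient.eq_zero_iff_mem.2 ?_
        exact Ideal.mul_mem_right _ _
          (Ideal.mem_sup_right (Ideal.mem_span_singleton_self θ))
      · exact bot_le
  have hdim := LinearMap.finrank_range_add_finrank_ker (φ.domRestrict (quotComponent K I s))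
  rw [hrange, (Submodule.equivMapOfInjective (quotComponent K I s).subtype
    (Submodule.subtype_injective _) _).finrank_eq, hker] at hdim
  rw [quotDim, ← hdim, quotDim]
  by_cases hes : e ≤ s
  · rw [if_pos hes, if_pos hes, quotDim,
      (Submodule.equivMapOfInjective μ hμ (quotComponent K I (s - e))).finrank_eq]
  · rw [if_neg hes, if_neg hes, finrank_bot]

theorem hilbertSeries_sup_span {I : Ideal (MvPolynomial (Fin n) K)}
    (hI : I.IsHomogeneous (homogeneousSubmodule (Fin n) K)) {θ : MvPolynomial (Fin n) K}
    {e : ℕ} (hθ : θ.IsHomogeneous e) (hreg : ∀ f, θ * f ∈ I → f ∈ I) :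
    hilbertSeries K (I ⊔ Ideal.span {θ}) = hilbertSeries K I * (1 - PowerSeries.X ^ e) := by
  ext s
  rw [mul_sub, mul_one, map_sub, PowerSeries.coeff_mul_X_pow']
  simp only [hilbertSeries, PowerSeries.coeff_mk]
  rw [quotDim_sup_span hI hθ hreg s]
  split_ifs <;> simp

theorem mem_of_isSMulRegular_quotient {R : Type*} [CommRing R] {I J : Ideal R} {r f : R}
    (h : IsSMulRegular ((R ⧸ I) ⧸ (J • ⊤ : Submodule R (R ⧸ I))) r)
    (hf : r * f ∈ I ⊔ J) : f ∈ I ⊔ J := by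
  have hJ : (J • ⊤ : Submodule R (R ⧸ I)) = Submodule.map (Submodule.mkQ I) J := by
    rw [← Submodule.range_mkQ I, LinearMap.range_eq_map, ← Submodule.map_smul'', smul_eq_mul,
      Ideal.mul_top]
  have hmem (x : R) : Submodule.Quotient.mk (p := (J • ⊤ : Submodule R (R ⧸ I)))
      (Submodule.mkQ I x) = 0 ↔ x ∈ I ⊔ J := by
    rw [Submodule.Quotient.mk_eq_zero, hJ, ← Submodule.mem_comap, Submodule.comap_map_mkQ]
  rw [← hmem] at hf ⊢
  refine h.right_eq_zero_of_smul ?_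
  rw [← Submodule.Quotient.mk_smul, ← map_smul, smul_eq_mul]
  exact hf

theorem isHomogeneous_sup_span {I : Ideal (MvPolynomial (Fin n) K)}
    (hI : I.IsHomogeneous (homogeneousSubmodule (Fin n) K)) {θ : MvPolynomial (Fin n) K}
    {e : ℕ} (hθ : θ.IsHomogeneous e) :
    (I ⊔ Ideal.span {θ}).IsHomogeneous (homogeneousSubmodule (Fin n) K) :=
  hI.sup (Ideal.homogeneous_span _ _ fun x hx => by
    rw [Set.mem_singleton_iff.1 hx]
    exact ⟨e, (mem_homogeneousSubmodule _ _).2 hθ⟩)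

theorem isHomogeneous_SRIdeal (Δ : Finset (Finset (Fin n))) :
    (SRIdeal K Δ).IsHomogeneous (homogeneousSubmodule (Fin n) K) := by
  refine Ideal.homogeneous_span _ _ ?_
  rintro _ ⟨σ, -, rfl⟩
  refine ⟨∑ _i ∈ σ, 1, (mem_homogeneousSubmodule _ _).2 ?_⟩
  exact IsHomogeneous.prod _ _ _ fun i _ => isHomogeneous_X _ _

theorem hilbertSeries_of_isWeaklyRegular {I : Ideal (MvPolynomial (Fin n) K)}
    (hI : I.IsHomogeneous (homogeneousSubmodule (Fin n) K)) {k : ℕ}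
    {θ : Fin k → MvPolynomial (Fin n) K} {deg : Fin k → ℕ}
    (hθ : ∀ i, (θ i).IsHomogeneous (deg i))
    (hreg : RingTheory.Sequence.IsWeaklyRegular (MvPolynomial (Fin n) K ⧸ I) (List.ofFn θ)) :
    hilbertSeries K (I ⊔ Ideal.span (Set.range θ)) =
      hilbertSeries K I * ∏ i, (1 - PowerSeries.X ^ deg i) := by
  have key : ∀ j (hj : j ≤ k),
      (I ⊔ Ideal.ofList ((List.ofFn θ).take j)).IsHomogeneous
        (homogeneousSubmodule (Fin n) K) ∧
      hilbertSeries K (I ⊔ Ideal.ofList ((List.ofFn θ).take j)) =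
        hilbertSeries K I * ∏ i : Fin j, (1 - PowerSeries.X ^ deg (i.castLE hj)) := by
    intro j
    induction j with
    | zero => intro _; simpa using hI
    | succ j ih =>
      intro hj
      obtain ⟨hhom, hser⟩ := ih (Nat.le_of_succ_le hj)
      have hlen : j < (List.ofFn θ).length := by simpa using hj
      have hget : (List.ofFn θ)[j] = θ ⟨j, hj⟩ := by simp
      have htake : I ⊔ Ideal.ofList ((List.ofFn θ).take (j + 1)) =
          I ⊔ Ideal.ofList ((List.ofFn θ).take j) ⊔ Ideal.span {θ ⟨j, hj⟩} := by
        rw [List.take_add_one, List.getElem?_eq_getElem hlen, Option.toList_some, hget,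
          Ideal.ofList_append, Ideal.ofList_singleton, sup_assoc]
      have hr := hreg.regular_mod_prev j hlen
      rw [hget] at hr
      rw [htake]
      refine ⟨isHomogeneous_sup_span hhom (hθ _), ?_⟩
      rw [hilbertSeries_sup_span hhom (hθ _) fun f => mem_of_isSMulRegular_quotient hr, hser,
        Fin.prod_univ_castSucc, mul_assoc]
      rfl
  have h := (key k le_rfl).2
  have hall : Ideal.ofList ((List.ofFn θ).take k) = Ideal.span (Set.range θ) := by
    rw [List.take_of_length_le (by simp), Ideal.ofList]
    congr 1
    ext x
    simp
  rw [hall] at h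
  simpa using h

/-- The Artinian reduction of `R/I_Δ` by a regular sequence of forms is nonzero in the degree
given by its Hilbert series. -/
theorem quotDim_ne_zero_of_isWeaklyRegular {Δ : Finset (Finset (Fin n))} (hΔ : IsComplex Δ)
    {d t : ℕ} (hdim : ∀ σ ∈ Δ, σ.card ≤ d + 1) {θ : Fin (d + 1) → MvPolynomial (Fin n) K}
    {deg : Fin (d + 1) → ℕ} (hpos : ∀ i, 0 < deg i) (hθ : ∀ i, (θ i).IsHomogeneous (deg i))
    (hreg : RingTheory.Sequence.IsWeaklyRegular (MvPolynomial (Fin n) K ⧸ SRIdeal K Δ)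
      (List.ofFn θ))
    (ht : ∑ i, deg i + (hPoly Δ d).natDegree = t + d + 1) :
    quotDim K (SRIdeal K Δ ⊔ Ideal.span (Set.range θ)) t ≠ 0 := by
  let G : Polynomial ℤ := ∏ i, ∑ j ∈ Finset.range (deg i), Polynomial.X ^ j
  have hmonic (i : Fin (d + 1)) :
      (∑ j ∈ Finset.range (deg i), (Polynomial.X : Polynomial ℤ) ^ j).Monic :=
    Polynomial.monic_geom_sum_X (hpos i).ne'
  have hG : G.Monic := Polynomial.monic_prod_of_monic _ _ fun i _ => hmonic i
  have hdeg1 (i : Fin (d + 1)) :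
      (∑ j ∈ Finset.range (deg i), (Polynomial.X : Polynomial ℤ) ^ j).natDegree + 1 = deg i := by
    have h := congrArg Polynomial.natDegree
      (geom_sum_mul (Polynomial.X : Polynomial ℤ) (deg i))
    rw [← Polynomial.C_1, (hmonic i).natDegree_mul (Polynomial.monic_X_sub_C 1),
      Polynomial.natDegree_X_sub_C, Polynomial.natDegree_X_pow_sub_C] at h
    exact h
  have hGdeg : G.natDegree + (d + 1) = ∑ i, deg i := by
    rw [Polynomial.natDegree_prod_of_monic _ _ fun i _ => hmonic i,
      ← Finset.sum_congr rfl fun i _ => hdeg1 i, Finset.sum_add_distrib]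
    simp
  have hGcoe : ((G : Polynomial ℤ) : PowerSeries ℤ) * (1 - PowerSeries.X) ^ (d + 1) =
      ∏ i, (1 - PowerSeries.X ^ deg i) := by
    have hconst : (1 - PowerSeries.X : PowerSeries ℤ) ^ (d + 1) =
        ∏ _i : Fin (d + 1), (1 - PowerSeries.X) := by simp
    rw [hconst, ← Polynomial.coeToPowerSeries.ringHom_apply, map_prod, ← Finset.prod_mul_distrib]
    refine Finset.prod_congr rfl fun i _ => ?_
    rw [mul_comm, ← mul_neg_geom_sum, map_sum]
    simp
  have hser : hilbertSeries K (SRIdeal K Δ ⊔ Ideal.span (Set.range θ)) =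
      ((hPoly Δ d * G : Polynomial ℤ) : PowerSeries ℤ) := by
    rw [hilbertSeries_of_isWeaklyRegular (isHomogeneous_SRIdeal Δ) hθ hreg, ← hGcoe,
      Polynomial.coe_mul, ← hilbertSeries_SRIdeal_mul (K := K) hΔ hdim]
    ring
  have hcoeff := congrArg (PowerSeries.coeff t) hser
  have htdeg : t = (hPoly Δ d * G).natDegree := by
    rw [mul_comm, hG.natDegree_mul' (hPoly_ne_zero hΔ hdim)]
    omega
  rw [hilbertSeries, PowerSeries.coeff_mk, Polynomial.coeff_coe, htdeg,
    Polynomial.coeff_natDegree, Polynomial.leadingCoeff_mul_monic hG, ← htdeg] at hcoeff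
  intro h0
  rw [h0, Nat.cast_zero, eq_comm, Polynomial.leadingCoeff_eq_zero] at hcoeff
  exact hPoly_ne_zero hΔ hdim hcoeff

end RegularSequence

/-- **Nonexistence of unexpected sops for collapsible complexes
(Corollary `c:nonexistence`).**
If `Δ` is a pure collapsible `d`-dimensional Cohen–Macaulay complex and
`a > 0` is fixed, then for every total degree `t > d(a-1)` there is no
`a`-unexpected system of parameters of `Δ` of total degree `t`. -/
theorem collapsible_no_unexpected_sop (K : Type) [Field K] [CharZero K]
    {n d a : ℕ} (Δ : Finset (Finset (Fin n)))
    (hcomplex : IsComplex Δ) (hdim : HasDim Δ d)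
    (hpure : IsPure Δ d) (hcol : Collapsible Δ) (ha : 0 < a) :
    ∀ t : ℕ, d * (a - 1) < t →
      ∀ (θ : Fin (d + 1) → MvPolynomial (Fin n) K) (deg : Fin (d + 1) → ℕ),
        ¬ IsUnexpectedSOP K Δ d a t θ deg := by
  rintro t ht θ deg ⟨hpos, hθ, -, hreg, hdeg, hlin, hpow, -⟩
  refine quotDim_ne_zero_of_isWeaklyRegular hcomplex hdim.1 hpos hθ hreg.toIsWeaklyRegular hdeg ?_
  have hbot : quotComponent K (SRIdeal K Δ ⊔ Ideal.span (Set.range θ)) t = ⊥ := by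
    rw [eq_bot_iff]
    rintro _ ⟨f, hf, rfl⟩
    exact Ideal.Quotient.eq_zero_iff_mem.2
      (mem_of_collapsible hcomplex hdim.1 hcol ht le_sup_left hpow hlin hf)
  rw [quotDim, hbot, finrank_bot]
end

section
/- Let K be a field of characteristic zero, let a > 0 be an integer, and let F ∈ K[x_1,…,x_n] be a nonzero homogeneous polynomial such that ∂F/∂x_1 + ⋯ + ∂F/∂x_n = 0 and such that no monomial appearing in F with nonzero coefficient is divisible by x_i^a for any i. Then deg F ≤ n(a−1)/2. -/
namespace MvPolynomial

lemma pderiv_pderiv_comm {σ K : Type*} [CommRing K] (i j : σ) (P : MvPolynomial σ K) :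
    pderiv i (pderiv j P) = pderiv j (pderiv i P) := by
  classical
  have h : ⁅(pderiv i : Derivation K (MvPolynomial σ K) (MvPolynomial σ K)),
      (pderiv j : Derivation K (MvPolynomial σ K) (MvPolynomial σ K))⁆ = 0 := by
    refine derivation_ext fun k => ?_
    rw [Derivation.commutator_apply]
    simp [pderiv_X, Pi.single_apply, apply_ite]
  have hP := DFunLike.congr_fun h P
  rw [Derivation.commutator_apply] at hP
  exact sub_eq_zero.1 hP

section Raising

variable {σ K : Type*} [Fintype σ] [CommRing K]

/-- The raising operator `∑ i, (c * x_i - x_i ^ 2 * ∂ / ∂x_i)` of an `sl₂`-action in which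
`∑ i, ∂ / ∂x_i` is the lowering operator. -/
noncomputable def raising (c : ℕ) : MvPolynomial σ K →ₗ[K] MvPolynomial σ K :=
  ∑ i, ((c : K) • LinearMap.mulLeft K (X i) -
    LinearMap.mulLeft K (X i ^ 2) ∘ₗ (pderiv i).toLinearMap)

lemma raising_apply (c : ℕ) (P : MvPolynomial σ K) :
    raising c P = ∑ i, ((c : MvPolynomial σ K) * (X i * P) - X i ^ 2 * pderiv i P) := by
  simp [raising, LinearMap.sum_apply, Algebra.smul_def]

lemma raising_monomial (c : ℕ) (s : σ →₀ ℕ) (r : K) :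
    raising c (monomial s r) =
      ∑ i, monomial (s + Finsupp.single i 1) (((c : K) - s i) * r) := by
  rw [raising_apply]
  refine Finset.sum_congr rfl fun i _ => ?_
  have hX : X i * monomial s r = monomial (s + Finsupp.single i 1) r := by
    rw [X, monomial_mul, one_mul, add_comm]
  rw [pow_two, mul_assoc, X_mul_pderiv_monomial, mul_smul_comm, hX, sub_mul, map_sub,
    ← nsmul_eq_mul, ← map_nsmul, ← map_nsmul, nsmul_eq_mul, nsmul_eq_mul]

lemma raising_mem_restrictDegree {c : ℕ} {P : MvPolynomial σ K}
    (hP : P ∈ restrictDegree σ K c) : raising c P ∈ restrictDegree σ K c := by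
  classical
  rw [mem_restrictDegree] at hP
  rw [P.as_sum, map_sum]
  refine Submodule.sum_mem _ fun s hs => ?_
  rw [raising_monomial]
  refine Submodule.sum_mem _ fun i _ => ?_
  rcases (hP s hs i).eq_or_lt with h | h
  · simp [h]
  · rw [mem_restrictDegree]
    intro t ht j
    obtain rfl := Finset.mem_singleton.1 (support_monomial_subset ht)
    have := hP s hs j
    rw [Finsupp.add_apply, Finsupp.single_apply]
    split_ifs with hij
    · subst hij; omega
    · omega

lemma IsHomogeneous.raising {c d : ℕ} {P : MvPolynomial σ K} (hP : P.IsHomogeneous d) :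
    (raising c P).IsHomogeneous (d + 1) := by
  classical
  rw [P.as_sum, map_sum]
  refine IsHomogeneous.sum _ _ _ fun s hs => ?_
  rw [raising_monomial]
  refine IsHomogeneous.sum _ _ _ fun i _ => isHomogeneous_monomial _ ?_
  rw [map_add, Finsupp.degree_single, ← hP (mem_support_iff.1 hs), Finsupp.degree_eq_weight_one]
  rfl

lemma sum_pderiv_raising {c d : ℕ} {P : MvPolynomial σ K} (hP : P.IsHomogeneous d) :
    ∑ j, pderiv j (raising c P) = raising c (∑ j, pderiv j P) +
      (((Fintype.card σ * c : ℕ) : K) - 2 * d) • P := by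
  classical
  have key (i j : σ) : pderiv j ((c : MvPolynomial σ K) * (X i * P) - X i ^ 2 * pderiv i P) =
      ((c : MvPolynomial σ K) * (X i * pderiv j P) - X i ^ 2 * pderiv i (pderiv j P)) +
      if i = j then (c : MvPolynomial σ K) * P - 2 * (X i * pderiv i P) else 0 := by
    have hcomm := pderiv_pderiv_comm j i P
    by_cases h : i = j
    · subst h
      simp [Derivation.leibniz, Derivation.leibniz_pow]
      ring
    · simp [Derivation.leibniz, Derivation.leibniz_pow, pderiv_X_of_ne h, hcomm, h]
  have euler : ∑ i, X i * pderiv i P = (d : MvPolynomial σ K) * P := by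
    rw [hP.sum_X_mul_pderiv, nsmul_eq_mul]
  simp_rw [map_sum, raising_apply, map_sum, key, Finset.sum_add_distrib]
  simp only [Finset.sum_ite_eq', Finset.mem_univ, if_true, Finset.sum_sub_distrib,
    ← Finset.mul_sum, euler]
  simp [Algebra.smul_def, show (C 2 : MvPolynomial σ K) = 2 from map_ofNat C 2]
  ring

lemma sum_pderiv_raising_iterate {c d : ℕ} {P : MvPolynomial σ K} (hP : P.IsHomogeneous d)
    (hdiv : ∑ i, pderiv i P = 0) (k : ℕ) :
    ∑ i, pderiv i ((raising c)^[k + 1] P) =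
      ((k + 1 : K) * (((Fintype.card σ * c : ℕ) : K) - 2 * d - k)) • (raising c)^[k] P := by
  have hom (k : ℕ) : ((MvPolynomial.raising c)^[k] P).IsHomogeneous (d + k) := by
    induction k with
    | zero => exact hP
    | succ k ih => rw [Function.iterate_succ_apply']; exact ih.raising
  induction k with
  | zero => simp [sum_pderiv_raising hP, hdiv]
  | succ k ih =>
    rw [Function.iterate_succ_apply', sum_pderiv_raising (hom (k + 1)), ih, map_smul,
      ← Function.iterate_succ_apply' (f := raising c), ← add_smul]
    congr 1
    push_cast
    ring

end Raising

end MvPolynomial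

open MvPolynomial

/-- **Divergence-free polynomials with small exponents have small degree
(Corollary `c:basecase` (1)).**
Over a field of characteristic zero, if `F` is a nonzero homogeneous
polynomial of degree `D` with `∂F/∂x_1 + ⋯ + ∂F/∂x_n = 0` such that no
monomial of `F` is divisible by any `x_i^a`, then `deg F ≤ n(a-1)/2`. -/
theorem divergence_free_degree_bound (K : Type) [Field K] [CharZero K]
    {n a D : ℕ} (ha : 0 < a) (F : MvPolynomial (Fin n) K)
    (hF0 : F ≠ 0) (hhom : F.IsHomogeneous D)
    (hdiv : ∑ i, MvPolynomial.pderiv i F = 0)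
    (hsupp : ∀ m ∈ F.support, ∀ i : Fin n, m i < a) :
    2 * D ≤ n * (a - 1) := by
  by_contra! hlt
  have mem (k : ℕ) : (raising (a - 1))^[k] F ∈ restrictDegree (Fin n) K (a - 1) := by
    induction k with
    | zero => exact (mem_restrictDegree _ _ _).2 fun m hm i => Nat.le_sub_one_of_lt (hsupp m hm i)
    | succ k ih => rw [Function.iterate_succ_apply']; exact raising_mem_restrictDegree ih
  have hom (k : ℕ) : ((raising (a - 1))^[k] F).IsHomogeneous (D + k) := by
    induction k with
    | zero => exact hhom
    | succ k ih => rw [Function.iterate_succ_apply']; exact ih.raising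
  have ne (k : ℕ) : (raising (a - 1))^[k] F ≠ 0 := by
    induction k with
    | zero => exact hF0
    | succ k ih =>
      intro h
      have hk := sum_pderiv_raising_iterate (c := a - 1) hhom hdiv k
      simp only [h, map_zero, Finset.sum_const_zero, Fintype.card_fin] at hk
      rcases mul_eq_zero.1 ((smul_eq_zero.1 hk.symm).resolve_right ih) with h1 | h1
      · exact Nat.cast_add_one_ne_zero k h1
      · have : ((n * (a - 1) : ℕ) : K) = ((2 * D + k : ℕ) : K) := by
          push_cast at h1 ⊢
          linear_combination h1
        have := Nat.cast_injective this
        omega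
  obtain ⟨m, hm⟩ := ne_zero_iff.1 (ne (n * (a - 1) + 1))
  have hdeg : m.degree = D + (n * (a - 1) + 1) := by
    rw [Finsupp.degree_eq_weight_one]
    exact hom _ hm
  have hle : m.degree ≤ n * (a - 1) := by
    rw [Finsupp.degree_eq_sum]
    simpa using Finset.sum_le_card_nsmul Finset.univ m (a - 1)
      fun i _ => (mem_restrictDegree _ _ _).1 (mem _) m (mem_support_iff.2 hm) i
  omega
end
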